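/- Let n ≥ 1, let ξ_1,…,ξ_n be pairwise distinct positive reals and η_1,…,η_n reals forming an n-point Gauss–Laguerre rule (exact on polynomials of degree ≤ 2n−1 for the weight e^{−t} on [0,∞)), and for ω > 0 let x_1(ω),…,x_{2n}(ω) denote the 2n superinterpolation points ±1 + iξ_j/ω. Let Ω > 0 and let p : [Ω,∞) → ℂ[X] assign to each ω a monic polynomial p(ω) of degree 2n with ∫_{−1}^{1} p(ω)(x)·x^k·e^{iωx} dx = 0 for k = 0,…,2n−1, with uniformly bounded coefficients, and with roots y_1(ω),…,y_{2n}(ω), i.e. p(ω) = ∏_{j=1}^{2n} (X − y_j(ω)). Then there exist C and Ω′ ≥ Ω such that for every ω ≥ Ω′ and every j ∈ {1,…,2n} there is an index l ∈ {1,…,2n} with |y_j(ω) − x_l(ω)| ≤ C·ω^{−2}; that is, each root of p(ω) approaches a superinterpolation point at rate O(ω^{−2}) as ω → ∞. -/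

import Mathlib

open Polynomial MeasureTheory

noncomputable def sgB (b : Bool) : ℂ := if b then 1 else -1

noncomputable def ndP {n : ℕ} (ξ : Fin n → ℝ) (ω : ℝ) (l : Bool × Fin n) : ℂ :=
  sgB l.1 + Complex.I * (ξ l.2 : ℂ) / (ω : ℂ)

noncomputable def GG (N : ℕ) (c : ℂ) (f : ℂ[X]) : ℂ[X] :=
  ∑ k ∈ Finset.range N, C (c ^ k) * derivative^[k] f

lemma GG_sub (N : ℕ) (c : ℂ) (f : ℂ[X]) (h : f.natDegree < N) :
    GG N c f - C c * derivative (GG N c f) = f := by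
  have h1 : C c * derivative (GG N c f) =
      ∑ k ∈ Finset.range N, C (c ^ (k+1)) * derivative^[k+1] f := by
    unfold GG
    rw [derivative_sum, Finset.mul_sum]
    refine Finset.sum_congr rfl fun k _ => ?_
    rw [derivative_C_mul, Function.iterate_succ_apply', pow_succ, C_mul]
    ring
  rw [h1]
  unfold GG
  rw [← Finset.sum_sub_distrib,
    Finset.sum_range_sub' (fun k => C (c ^ k) * derivative^[k] f), iterate_derivative_eq_zero h]
  simp

lemma GG_int (N : ℕ) (ω : ℝ) (hω : ω ≠ 0) (f : ℂ[X]) (h : f.natDegree < N) :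
    (Complex.I * ω) * ∫ x in (-1 : ℝ)..1, f.eval (x : ℂ) * Complex.exp (Complex.I * ω * x) =
    Complex.exp (Complex.I * ω) * (GG N (Complex.I / ω) f).eval 1
      - Complex.exp (-(Complex.I * ω)) * (GG N (Complex.I / ω) f).eval (-1) := by
  have hc : (ω : ℂ) ≠ 0 := by exact_mod_cast hω
  set G := GG N (Complex.I / ω) f with hG
  have hd : ∀ x : ℝ, HasDerivAt (fun x : ℝ => Complex.exp (Complex.I * ω * x) * G.eval (x : ℂ))
      ((Complex.I * ω) * (f.eval (x : ℂ) * Complex.exp (Complex.I * ω * x))) x := by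
    intro x
    have h1 : HasDerivAt (fun z : ℂ => Complex.exp (Complex.I * ω * z) * G.eval z)
      (Complex.exp (Complex.I * ω * x) * (Complex.I * ω) * G.eval (x : ℂ) +
        Complex.exp (Complex.I * ω * x) * (derivative G).eval (x : ℂ)) (x : ℂ) := by
      have h2 : HasDerivAt (fun z : ℂ => Complex.exp (Complex.I * ω * z))
          (Complex.exp (Complex.I * ω * x) * (Complex.I * ω)) (x : ℂ) := by
        simpa using ((hasDerivAt_id (x : ℂ)).const_mul (Complex.I * ω)).cexp
      exact h2.mul (G.hasDerivAt (x : ℂ))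
    convert! h1.comp_ofReal using 1
    have h3 := congrArg (eval (x : ℂ)) (GG_sub N (Complex.I / ω) f h)
    rw [← hG] at h3
    simp only [eval_sub, eval_mul, eval_C] at h3
    rw [← h3]
    field_simp
    linear_combination (-eval (x : ℂ) (derivative G)) * Complex.I_sq
  rw [← intervalIntegral.integral_const_mul,
    intervalIntegral.integral_eq_sub_of_hasDerivAt (fun x _ => hd x)]
  · simp
  · apply Continuous.intervalIntegrable
    fun_prop

lemma GG_eval (N : ℕ) (c s : ℂ) (f : ℂ[X]) :
    (GG N c f).eval s = ∑ k ∈ Finset.range N, c ^ k * (k.factorial : ℂ) * (taylor s f).coeff k := by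
  unfold GG
  rw [eval_finsetSum]
  refine Finset.sum_congr rfl fun k _ => ?_
  rw [taylor_coeff, ← factorial_smul_hasseDeriv]
  simp [mul_assoc]

lemma GL_eval {n : ℕ} (ξ η : Fin n → ℝ) (N : ℕ) (c s : ℂ) (f : ℂ[X]) (h : f.natDegree < N) :
    ∑ j, (η j : ℂ) * f.eval (s + c * ξ j) =
      ∑ k ∈ Finset.range N, c ^ k * ((∑ j, η j * ξ j ^ k : ℝ) : ℂ) * (taylor s f).coeff k := by
  have : ∀ j, f.eval (s + c * ξ j) = ∑ k ∈ Finset.range N, (taylor s f).coeff k * (c * ξ j) ^ k := by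
    intro j
    rw [add_comm, ← taylor_eval, eval_eq_sum_range' (by rwa [natDegree_taylor])]
  simp only [this, Finset.mul_sum]
  rw [Finset.sum_comm]
  refine Finset.sum_congr rfl fun k _ => ?_
  push_cast
  rw [Finset.mul_sum, Finset.sum_mul]
  refine Finset.sum_congr rfl fun j _ => ?_
  ring

lemma mono_int (k : ℕ) : IntegrableOn (fun t : ℝ => t ^ k * Real.exp (-t)) (Set.Ioi 0) := by
  have := Real.GammaIntegral_convergent (s := k + 1) (by positivity)
  refine this.congr_fun (fun t _ => ?_) measurableSet_Ioi
  simp [mul_comm]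

lemma mono_val (k : ℕ) : ∫ t in Set.Ioi (0 : ℝ), t ^ k * Real.exp (-t) = k.factorial := by
  rw [← Real.Gamma_nat_eq_factorial, Real.Gamma_eq_integral (by positivity)]
  refine setIntegral_congr_fun measurableSet_Ioi (fun t _ => ?_)
  simp [mul_comm]

lemma poly_int (q : ℝ[X]) :
    IntegrableOn (fun t : ℝ => q.eval t * Real.exp (-t)) (Set.Ioi 0) := by
  induction q using Polynomial.induction_on' with
  | add p q hp hq => simpa [add_mul] using! hp.add hq
  | monomial k a => simpa [mul_assoc] using! (mono_int k).const_mul a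

lemma eta_ne (n : ℕ) (ξ η : Fin n → ℝ)
    (hGL : ∀ q : Polynomial ℝ, q.natDegree ≤ 2 * n - 1 →
      ∑ j, η j * q.eval (ξ j) = ∫ t in Set.Ioi (0 : ℝ), q.eval t * Real.exp (-t)) (l : Fin n) :
    η l ≠ 0 := by
  intro h0
  set r : ℝ[X] := Lagrange.nodal (Finset.univ.erase l) ξ with hr
  have hdeg : (r ^ 2).natDegree ≤ 2 * n - 1 := by
    refine natDegree_pow_le.trans ?_
    rw [hr, Lagrange.natDegree_nodal, Finset.card_erase_of_mem (Finset.mem_univ _)]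
    simp; omega
  have h1 := hGL (r ^ 2) hdeg
  rw [Finset.sum_eq_zero] at h1
  · have hi := poly_int (r ^ 2)
    have hne : ∀ᵐ t ∂(volume.restrict (Set.Ioi (0 : ℝ))), (r ^ 2).eval t * Real.exp (-t) = 0 := by
      have := (integral_eq_zero_iff_of_nonneg (μ := volume.restrict (Set.Ioi (0 : ℝ)))
        (f := fun t => (r ^ 2).eval t * Real.exp (-t))
        (fun t => by simp only [eval_pow, Pi.zero_apply]; positivity) hi).1 h1.symm
      exact this
    have hfin : {t : ℝ | r.eval t = 0}.Finite := by
      have hr0 : r ≠ 0 := Lagrange.nodal_ne_zero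
      refine (r.rootSet_finite ℝ).subset ?_
      intro t ht
      simp only [Set.mem_ofPred_eq] at ht
      simp [mem_rootSet, hr0, ht]
    have h2 : ∀ᵐ t ∂(volume.restrict (Set.Ioi (0 : ℝ))), r.eval t ≠ 0 := by
      have : ∀ᵐ t ∂(volume : Measure ℝ), t ∉ {t : ℝ | r.eval t = 0} :=
        measure_eq_zero_iff_ae_notMem.1 (hfin.measure_zero _)
      exact ae_restrict_of_ae this
    have h3 : ∀ᵐ t ∂(volume.restrict (Set.Ioi (0 : ℝ))), False := by
      filter_upwards [hne, h2] with t a b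
      simp [b, Real.exp_ne_zero] at a
    rw [Filter.eventually_false_iff_eq_bot, ae_eq_bot, Measure.restrict_eq_zero] at h3
    simp at h3
  · intro j _
    by_cases hj : j = l
    · simp [hj, h0]
    · rw [eval_pow, hr, Lagrange.eval_nodal_at_node (by simp [hj])]; simp

open Filter Asymptotics in
def BF (f : ℝ → ℂ[X]) : Prop :=
  ∀ k, (fun ω : ℝ => (f ω).coeff k) =O[atTop] (fun _ => (1 : ℝ))

lemma BF.mul {f g : ℝ → ℂ[X]} (hf : BF f) (hg : BF g) : BF (fun ω => f ω * g ω) := by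
  intro k
  simp only [coeff_mul]
  refine Asymptotics.IsBigO.fun_sum fun i _ => ?_
  simpa using (hf i.1).mul (hg i.2)

lemma BF.sum {ι : Type*} (s : Finset ι) {f : ι → ℝ → ℂ[X]} (hf : ∀ i ∈ s, BF (f i)) :
    BF (fun ω => ∑ i ∈ s, f i ω) := by
  intro k
  simp only [finsetSum_coeff]
  exact Asymptotics.IsBigO.fun_sum fun i hi => hf i hi k

lemma BF.const (g : ℂ[X]) : BF (fun _ => g) := fun _ =>
  Asymptotics.isBigO_const_const _ one_ne_zero _

lemma BF.prod {ι : Type*} (s : Finset ι) {f : ι → ℝ → ℂ[X]} (hf : ∀ i ∈ s, BF (f i)) :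
    BF (fun ω => ∏ i ∈ s, f i ω) := by
  classical
  induction s using Finset.induction_on with
  | empty => simpa using BF.const 1
  | insert a s ha ih =>
    simp only [Finset.prod_insert ha]
    exact (hf a (by simp)).mul (ih fun i hi => hf i (by simp [hi]))

lemma BF.C {g : ℝ → ℂ} (hg : g =O[Filter.atTop] (fun _ => (1 : ℝ))) : BF (fun ω => C (g ω)) := by
  intro k
  by_cases hk : k = 0
  · simpa [hk] using hg
  · simp only [coeff_C, if_neg hk]
    exact Asymptotics.isBigO_zero _ _

lemma BF.add {f g : ℝ → ℂ[X]} (hf : BF f) (hg : BF g) : BF (fun ω => f ω + g ω) := by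
  intro k
  simp only [coeff_add]
  exact (hf k).add (hg k)

lemma BF.congr {f g : ℝ → ℂ[X]} (hf : BF f) (h : f =ᶠ[Filter.atTop] g) : BF g := by
  intro k
  refine (hf k).congr' ?_ Filter.EventuallyEq.rfl
  filter_upwards [h] with ω hω
  rw [hω]

lemma BF.taylor {f : ℝ → ℂ[X]} (hf : BF f) (N : ℕ)
    (hN : ∀ᶠ ω in Filter.atTop, (f ω).natDegree < N) (s : ℂ) :
    BF (fun ω => taylor s (f ω)) := by
  have h1 : BF (fun ω => ∑ k ∈ Finset.range N, Polynomial.C ((f ω).coeff k) * (X + Polynomial.C s) ^ k) :=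
    BF.sum _ fun k _ => (BF.C (hf k)).mul (BF.const _)
  refine h1.congr ?_
  filter_upwards [hN] with ω hω
  conv_rhs => rw [(f ω).as_sum_range' N hω, map_sum]
  simp [taylor_monomial]

lemma nd_bdd {n : ℕ} (ξ : Fin n → ℝ) (l : Bool × Fin n) :
    (fun ω => ndP ξ ω l) =O[Filter.atTop] (fun _ => (1 : ℝ)) := by
  unfold ndP
  refine (Asymptotics.isBigO_const_const _ one_ne_zero _).add ?_
  refine Asymptotics.IsBigO.of_bound ‖ξ l.2‖ ?_
  filter_upwards [Filter.eventually_ge_atTop 1] with ω hω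
  have : (1:ℝ) ≤ |ω| := hω.trans (le_abs_self _)
  simp
  exact div_le_self (abs_nonneg _) this

lemma BF_nodal {n : ℕ} (ξ : Fin n → ℝ) (S : Finset (Bool × Fin n)) :
    BF (fun ω => Lagrange.nodal S (ndP ξ ω)) := by
  unfold Lagrange.nodal
  refine BF.prod _ fun l _ => ?_
  have h0 : (fun ω => -ndP ξ ω l) =O[Filter.atTop] (fun _ => (1 : ℝ)) := (nd_bdd ξ l).neg_left
  have := (BF.const X).add (BF.C h0)
  simpa [sub_eq_add_neg] using this

lemma err {n : ℕ} (ξ η : Fin n → ℝ)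
    (hGL : ∀ q : Polynomial ℝ, q.natDegree ≤ 2 * n - 1 →
      ∑ j, η j * q.eval (ξ j) = ∫ t in Set.Ioi (0 : ℝ), q.eval t * Real.exp (-t))
    (N : ℕ) (f : ℝ → ℂ[X]) (hf : BF f)
    (hN : ∀ᶠ ω in Filter.atTop, (f ω).natDegree < N) (s : ℂ) :
    (fun ω : ℝ => (GG N (Complex.I / ω) (f ω)).eval s -
      ∑ j, (η j : ℂ) * (f ω).eval (s + (Complex.I / ω) * ξ j))
      =O[Filter.atTop] (fun ω : ℝ => (ω ^ (2 * n))⁻¹) := by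
  have ht := hf.taylor N hN s
  have h1 : (fun ω : ℝ => ∑ k ∈ Finset.range N, (Complex.I / ω) ^ k *
      ((k.factorial : ℂ) - ((∑ j, η j * ξ j ^ k : ℝ) : ℂ)) * (taylor s (f ω)).coeff k)
      =O[Filter.atTop] (fun ω : ℝ => (ω ^ (2 * n))⁻¹) := by
    refine Asymptotics.IsBigO.fun_sum fun k _ => ?_
    by_cases hk : k < 2 * n
    · have : (∑ j, η j * ξ j ^ k : ℝ) = k.factorial := by
        have := hGL (X ^ k) (by rw [natDegree_X_pow]; omega)
        simpa [mono_val] using this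
      rw [this]
      simpa using Asymptotics.isBigO_zero _ _
    · push Not at hk
      have h2 : (fun ω : ℝ => (Complex.I / ω) ^ k) =O[Filter.atTop]
          (fun ω : ℝ => (ω ^ (2 * n))⁻¹) := by
        refine Asymptotics.IsBigO.of_bound 1 ?_
        filter_upwards [Filter.eventually_ge_atTop 1] with ω hω
        have : (1:ℝ) ≤ |ω| := hω.trans (le_abs_self _)
        simp only [norm_pow, norm_div, Complex.norm_I, Complex.norm_real, norm_inv, one_mul,
          Real.norm_eq_abs, one_div, inv_pow]
        gcongr
      have h3 := (h2.mul (Asymptotics.isBigO_const_const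
        ((k.factorial : ℂ) - ((∑ j, η j * ξ j ^ k : ℝ) : ℂ)) (one_ne_zero (α := ℝ)) _)).mul (ht k)
      simpa using h3
  refine h1.congr' ?_ Filter.EventuallyEq.rfl
  filter_upwards [hN] with ω hω
  rw [GG_eval, GL_eval ξ η N _ _ _ hω, ← Finset.sum_sub_distrib]
  refine Finset.sum_congr rfl fun k _ => ?_
  ring

lemma orth {n : ℕ} {P : ℂ[X]} {ω : ℝ}
    (horth : ∀ k < 2 * n, ∫ x in (-1 : ℝ)..1,
      P.eval (x : ℂ) * (x : ℂ) ^ k * Complex.exp (Complex.I * ω * x) = 0)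
    (Q : ℂ[X]) (hQ : Q.natDegree < 2 * n) :
    ∫ x in (-1 : ℝ)..1, (P * Q).eval (x : ℂ) * Complex.exp (Complex.I * ω * x) = 0 := by
  have : ∀ x : ℝ, (P * Q).eval (x : ℂ) * Complex.exp (Complex.I * ω * x) =
      ∑ k ∈ Finset.range (2 * n), Q.coeff k *
        (P.eval (x : ℂ) * (x : ℂ) ^ k * Complex.exp (Complex.I * ω * x)) := by
    intro x
    rw [eval_mul, eval_eq_sum_range' hQ, Finset.mul_sum, Finset.sum_mul]
    refine Finset.sum_congr rfl fun k _ => ?_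
    ring
  simp only [this]
  rw [intervalIntegral.integral_finsetSum]
  · refine Finset.sum_eq_zero fun k hk => ?_
    rw [intervalIntegral.integral_const_mul, horth k (Finset.mem_range.1 hk), mul_zero]
  · intro k _
    apply Continuous.intervalIntegrable
    fun_prop

/-- lower bound for the nodal weights -/
lemma Q_lower {n : ℕ} (ξ : Fin n → ℝ) (l : Bool × Fin n) {ω : ℝ} (hω : 0 < ω) :
    (∏ m ∈ Finset.univ.erase l.2, |ξ l.2 - ξ m|) * (ω ^ (n - 1))⁻¹ ≤
      ‖(Lagrange.nodal (Finset.univ.erase l) (ndP ξ ω)).eval (ndP ξ ω l)‖ := by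
  obtain ⟨b, j⟩ := l
  rw [Lagrange.eval_nodal, norm_prod]
  have hsplit : (Finset.univ.erase (b, j) : Finset (Bool × Fin n)) =
      ((Finset.univ.erase j).image (fun m => (b, m))) ∪ (Finset.univ.image (fun m => (!b, m))) := by
    ext ⟨c, m⟩
    cases b <;> cases c <;> simp [eq_comm]
  have hdisj : Disjoint ((Finset.univ.erase j).image (fun m => (b, m)))
      (Finset.univ.image (fun m : Fin n => (!b, m))) := by
    rw [Finset.disjoint_left]
    rintro ⟨c, m⟩ h1 h2
    cases b <;> cases c <;> simp at h1 h2
  rw [hsplit, Finset.prod_union hdisj, Finset.prod_image (by intro a _ c _ h; simpa using h),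
    Finset.prod_image (by intro a _ c _ h; simpa using h)]
  have hA : ∏ m ∈ Finset.univ.erase j, ‖ndP ξ ω (b, j) - ndP ξ ω (b, m)‖ =
      (∏ m ∈ Finset.univ.erase j, |ξ j - ξ m|) * (ω ^ (n - 1))⁻¹ := by
    have : ∀ m, ‖ndP ξ ω (b, j) - ndP ξ ω (b, m)‖ = |ξ j - ξ m| * ω⁻¹ := by
      intro m
      have : ndP ξ ω (b, j) - ndP ξ ω (b, m) = Complex.I * ((ξ j - ξ m : ℝ) : ℂ) * ((ω⁻¹ : ℝ) : ℂ) := by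
        simp only [ndP]; push_cast; ring
      rw [this, norm_mul, norm_mul, Complex.norm_I, Complex.norm_real, Complex.norm_real,
        Real.norm_eq_abs, Real.norm_eq_abs, abs_of_pos (inv_pos.2 hω), one_mul]
    simp only [this]
    rw [Finset.prod_mul_distrib, Finset.prod_const, Finset.card_erase_of_mem (Finset.mem_univ _)]
    simp
  rw [hA]
  refine le_mul_of_one_le_right (by positivity) ?_
  refine Finset.prod_induction _ (fun r : ℝ => 1 ≤ r) (fun _ _ => one_le_mul_of_one_le_of_one_le) le_rfl ?_
  intro m _
  have h1 := Complex.abs_re_le_norm (ndP ξ ω (b, j) - ndP ξ ω (!b, m))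
  refine le_trans ?_ h1
  have : ∀ r : ℝ, (Complex.I * (r : ℂ) / (ω : ℂ)).re = 0 := by
    intro r
    have : Complex.I * (r : ℂ) / (ω : ℂ) = ((r / ω : ℝ) : ℂ) * Complex.I := by push_cast; ring
    rw [this]; simp
  simp only [ndP, Complex.sub_re, Complex.add_re, this]
  cases b <;> norm_num [sgB]

lemma key {n : ℕ} (hn : 1 ≤ n) (ξ η : Fin n → ℝ) (hξinj : Function.Injective ξ)
    (hGL : ∀ q : Polynomial ℝ, q.natDegree ≤ 2 * n - 1 →
      ∑ j, η j * q.eval (ξ j) = ∫ t in Set.Ioi (0 : ℝ), q.eval t * Real.exp (-t))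
    (Ω : ℝ) (p : ℝ → Polynomial ℂ)
    (hmonic : ∀ ω ≥ Ω, (p ω).Monic ∧ (p ω).natDegree = 2 * n)
    (horth : ∀ ω ≥ Ω, ∀ k < 2 * n, ∫ x in (-1 : ℝ)..1,
      (p ω).eval (x : ℂ) * (x : ℂ) ^ k * Complex.exp (Complex.I * ω * x) = 0)
    (hbound : ∃ B : ℝ, ∀ ω ≥ Ω, ∀ k : ℕ, ‖(p ω).coeff k‖ ≤ B) (l : Bool × Fin n) :
    ∃ K : ℝ, ∀ᶠ ω in Filter.atTop,
      ‖Lagrange.nodalWeight Finset.univ (ndP ξ ω) l * (p ω).eval (ndP ξ ω l)‖ ≤ K / ω ^ 2 := by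
  set Q : ℝ → ℂ[X] := fun ω => Lagrange.nodal (Finset.univ.erase l) (ndP ξ ω) with hQ
  have hQdeg : ∀ ω, (Q ω).natDegree = 2 * n - 1 := by
    intro ω
    rw [hQ, Lagrange.natDegree_nodal, Finset.card_erase_of_mem (Finset.mem_univ _)]
    simp
  have hpB : BF p := by
    obtain ⟨B, hB⟩ := hbound
    intro k
    refine Asymptotics.IsBigO.of_bound B ?_
    filter_upwards [Filter.eventually_ge_atTop Ω] with ω hω
    simpa using hB ω hω k
  have hf : BF (fun ω => p ω * Q ω) := hpB.mul (BF_nodal ξ _)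
  have hN' : ∀ ω ≥ Ω, (p ω * Q ω).natDegree < 4 * n := by
    intro ω hω
    refine natDegree_mul_le.trans_lt ?_
    rw [hQdeg, (hmonic ω hω).2]; omega
  have hN : ∀ᶠ ω in Filter.atTop, (p ω * Q ω).natDegree < 4 * n := by
    filter_upwards [Filter.eventually_ge_atTop Ω] with ω hω using hN' ω hω
  have hE := (err ξ η hGL (4 * n) _ hf hN (sgB l.1)).norm_left.add
    (err ξ η hGL (4 * n) _ hf hN (sgB (!l.1))).norm_left
  obtain ⟨K, hK⟩ := hE.bound
  set D : ℝ := ∏ m ∈ Finset.univ.erase l.2, |ξ l.2 - ξ m| with hD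
  have hDpos : 0 < D := by
    refine Finset.prod_pos fun m hm => ?_
    rw [abs_pos, sub_ne_zero]
    intro h
    exact (Finset.ne_of_mem_erase hm) (hξinj h).symm
  have hη : 0 < |η l.2| := abs_pos.2 (eta_ne n ξ η hGL l.2)
  refine ⟨K / (|η l.2| * D ^ 2), ?_⟩
  filter_upwards [hK, Filter.eventually_ge_atTop Ω, Filter.eventually_gt_atTop 0] with ω hKω hω hω0
  have hx : ∀ b j, sgB b + Complex.I / (ω : ℂ) * (ξ j : ℂ) = ndP ξ ω (b, j) := by
    intro b j; simp only [ndP]; ring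
  simp only [hx] at hKω
  have hz : ∀ m, m ≠ l → (p ω * Q ω).eval (ndP ξ ω m) = 0 := by
    intro m hm
    rw [eval_mul, hQ, Lagrange.eval_nodal_at_node (by simp [hm]), mul_zero]
  have hS0 : ∑ j, (η j : ℂ) * (p ω * Q ω).eval (ndP ξ ω (!l.1, j)) = 0 := by
    refine Finset.sum_eq_zero fun j _ => ?_
    rw [hz _ (by intro h; have := congrArg Prod.fst h; simp at this), mul_zero]
  have hS1 : ∑ j, (η j : ℂ) * (p ω * Q ω).eval (ndP ξ ω (l.1, j)) =
      η l.2 * (p ω * Q ω).eval (ndP ξ ω l) := by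
    rw [Finset.sum_eq_single l.2]
    · intro j _ hj
      rw [hz _ (by intro h; exact hj (congrArg Prod.snd h)), mul_zero]
    · simp
  rw [hS0, hS1, sub_zero] at hKω
  have hGeq : ‖(GG (4 * n) (Complex.I / ω) (p ω * Q ω)).eval (sgB l.1)‖ =
      ‖(GG (4 * n) (Complex.I / ω) (p ω * Q ω)).eval (sgB (!l.1))‖ := by
    have h1 := GG_int (4 * n) ω hω0.ne' (p ω * Q ω) (hN' ω hω)
    rw [orth (horth ω hω) (Q ω) (by rw [hQdeg]; omega), mul_zero] at h1
    have h2 := congrArg norm (sub_eq_zero.1 h1.symm)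
    have e1 : ‖Complex.exp (Complex.I * ω)‖ = 1 := by
      rw [mul_comm]; exact Complex.norm_exp_ofReal_mul_I ω
    have e2 : ‖Complex.exp (-(Complex.I * ω))‖ = 1 := by
      rw [Complex.exp_neg, norm_inv, e1, inv_one]
    rw [norm_mul, norm_mul, e1, e2, one_mul, one_mul] at h2
    cases l.1
    · simpa [sgB] using h2.symm
    · simpa [sgB] using h2
  have hmain : ‖(η l.2 : ℂ) * (p ω * Q ω).eval (ndP ξ ω l)‖ ≤ K * (ω ^ (2 * n))⁻¹ := by
    have h3 : ‖(ω ^ (2 * n))⁻¹‖ = (ω ^ (2 * n))⁻¹ := by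
      rw [Real.norm_eq_abs, abs_of_pos (by positivity)]
    rw [h3, ← hGeq] at hKω
    refine le_trans ?_ ((le_abs_self _).trans hKω)
    set a := (GG (4 * n) (Complex.I / ω) (p ω * Q ω)).eval (sgB l.1)
    set e := (η l.2 : ℂ) * (p ω * Q ω).eval (ndP ξ ω l)
    calc ‖e‖ = ‖a - (a - e)‖ := by congr 1; ring
      _ ≤ ‖a‖ + ‖a - e‖ := norm_sub_le _ _
      _ = _ := add_comm _ _
  have hlow := Q_lower ξ l hω0
  rw [← hD] at hlow
  rw [Lagrange.nodalWeight_eq_eval_nodal_erase_inv]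
  change ‖((Q ω).eval (ndP ξ ω l))⁻¹ * _‖ ≤ _
  change _ ≤ ‖(Q ω).eval (ndP ξ ω l)‖ at hlow
  rw [eval_mul, norm_mul, norm_mul, Complex.norm_real, Real.norm_eq_abs] at hmain
  rw [norm_mul, norm_inv]
  set q := ‖(Q ω).eval (ndP ξ ω l)‖
  set P := ‖(p ω).eval (ndP ξ ω l)‖ with hP
  have hP0 : 0 ≤ P := norm_nonneg _
  have hlow' : D ≤ q * ω ^ (n - 1) := by
    rwa [← div_eq_mul_inv, div_le_iff₀ (by positivity)] at hlow
  have hq : 0 < q := lt_of_lt_of_le (by positivity) hlow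
  have h4 : |η l.2| * (P * q) * ω ^ (2 * n) ≤ K := by
    rwa [← div_eq_mul_inv, le_div_iff₀ (by positivity)] at hmain
  have hpw : ω ^ (2 * n) = (ω ^ (n - 1)) ^ 2 * ω ^ 2 := by
    rw [← pow_mul, ← pow_add]; congr 1; omega
  rw [div_div, le_div_iff₀ (by positivity)]
  refine le_trans ?_ h4
  rw [hpw]
  have h5 : D ^ 2 ≤ (q * ω ^ (n - 1)) ^ 2 := by gcongr
  calc q⁻¹ * P * (|η l.2| * D ^ 2 * ω ^ 2)
      ≤ q⁻¹ * P * (|η l.2| * (q * ω ^ (n - 1)) ^ 2 * ω ^ 2) := by gcongr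
    _ = _ := by field_simp

lemma ndP_inj {n : ℕ} (ξ : Fin n → ℝ) (hξinj : Function.Injective ξ) {ω : ℝ} (hω : 0 < ω) :
    Function.Injective (ndP ξ ω) := by
  rintro l m h
  by_contra hne
  have h1 := Q_lower ξ l hω
  rw [Lagrange.eval_nodal, Finset.prod_eq_zero (i := m) (by simp [Ne.symm hne]) (by simp [h]),
    norm_zero] at h1
  have : 0 < ∏ m ∈ Finset.univ.erase l.2, |ξ l.2 - ξ m| := by
    refine Finset.prod_pos fun m hm => ?_
    rw [abs_pos, sub_ne_zero]
    intro h
    exact (Finset.ne_of_mem_erase hm) (hξinj h).symm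
  have : 0 < (∏ m ∈ Finset.univ.erase l.2, |ξ l.2 - ξ m|) * (ω ^ (n - 1))⁻¹ := by positivity
  linarith

lemma root_near {n : ℕ} (hn : 1 ≤ n) (v : Bool × Fin n → ℂ) (hv : Function.Injective v) (P : ℂ[X])
    (hP : P.Monic) (hdeg : P.natDegree = 2 * n) (ε : ℝ)
    (hε : ∀ l, ‖Lagrange.nodalWeight Finset.univ v l * P.eval (v l)‖ ≤ ε) (z : ℂ)
    (hz : P.eval z = 0) : ∃ l, ‖z - v l‖ ≤ (2 * n) * ε := by
  have l0 : Bool × Fin n := (true, ⟨0, hn⟩)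
  have hε0 : 0 ≤ ε := (norm_nonneg _).trans (hε l0)
  by_cases hx : ∀ i ∈ (Finset.univ : Finset (Bool × Fin n)), z ≠ v i
  · by_contra! hcon
    have hcard : (Finset.univ : Finset (Bool × Fin n)).card = 2 * n := by simp
    have hW := Lagrange.nodal_monic (s := (Finset.univ : Finset (Bool × Fin n))) (v := v)
    have hlt : (P - Lagrange.nodal Finset.univ v).degree <
        (Finset.univ : Finset (Bool × Fin n)).card := by
      have hd : P.degree = (2 * n : ℕ) := by rw [degree_eq_natDegree hP.ne_zero, hdeg]
      have := degree_sub_lt_left (p := P) (q := Lagrange.nodal Finset.univ v)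
        (by rw [hd, Lagrange.degree_nodal, hcard]) hP.ne_zero
        (by rw [hP.leadingCoeff, hW.leadingCoeff])
      rwa [hd, ← hcard] at this
    have h1 := Lagrange.eq_interpolate_of_eval_eq (fun l => P.eval (v l)) hv.injOn hlt
      (fun i hi => by rw [eval_sub, Lagrange.eval_nodal_at_node hi, sub_zero])
    have h2 := congrArg (eval z) h1
    rw [Lagrange.eval_interpolate_not_at_node _ hx, eval_sub, hz, zero_sub] at h2
    have hW0 := Lagrange.eval_nodal_not_at_node hx
    have h3 : ∑ i, Lagrange.nodalWeight Finset.univ v i * (z - v i)⁻¹ * P.eval (v i) = -1 := by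
      apply mul_left_cancel₀ hW0
      rw [← h2]; ring
    have h4 : (1 : ℝ) ≤ ∑ i, ε * ‖z - v i‖⁻¹ := by
      calc (1 : ℝ) = ‖∑ i, Lagrange.nodalWeight Finset.univ v i * (z - v i)⁻¹ * P.eval (v i)‖ := by
            rw [h3]; simp
        _ ≤ ∑ i, ‖Lagrange.nodalWeight Finset.univ v i * (z - v i)⁻¹ * P.eval (v i)‖ :=
            norm_sum_le _ _
        _ ≤ _ := by
            refine Finset.sum_le_sum fun i _ => ?_
            rw [mul_right_comm, norm_mul, norm_inv]
            exact mul_le_mul_of_nonneg_right (hε i) (by positivity)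
    have h5 : ∑ i, ε * ‖z - v i‖⁻¹ < ∑ _i : Bool × Fin n, ((2 * n : ℕ) : ℝ)⁻¹ := by
      refine Finset.sum_lt_sum_of_nonempty ⟨l0, Finset.mem_univ _⟩ fun i hi => ?_
      have hpos : 0 < ‖z - v i‖ := norm_pos_iff.2 (sub_ne_zero.2 (hx i hi))
      have hn' : (0 : ℝ) < 2 * n := by positivity
      rw [← div_eq_mul_inv, div_lt_iff₀ hpos, inv_mul_eq_div, lt_div_iff₀ (by push_cast; exact hn')]
      have := hcon i
      push_cast; linarith
    rw [Finset.sum_const, hcard, nsmul_eq_mul, mul_inv_cancel₀ (by positivity)] at h5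
    linarith
  · push Not at hx
    obtain ⟨i, _, hi⟩ := hx
    exact ⟨i, by rw [hi, sub_self, norm_zero]; positivity⟩

theorem roots_approach_superinterpolation_points
    (n : ℕ) (hn : 1 ≤ n) (ξ η : Fin n → ℝ)
    (hξpos : ∀ j, 0 < ξ j) (hξinj : Function.Injective ξ)
    (hGL : ∀ q : Polynomial ℝ, q.natDegree ≤ 2 * n - 1 →
      ∑ j, η j * q.eval (ξ j) = ∫ t in Set.Ioi (0 : ℝ), q.eval t * Real.exp (-t))
    (Ω : ℝ) (hΩ : 0 < Ω) (p : ℝ → Polynomial ℂ) (y : ℝ → Fin (2 * n) → ℂ)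
    (hmonic : ∀ ω ≥ Ω, (p ω).Monic ∧ (p ω).natDegree = 2 * n)
    (horth : ∀ ω ≥ Ω, ∀ k < 2 * n, ∫ x in (-1 : ℝ)..1,
      (p ω).eval (x : ℂ) * (x : ℂ) ^ k * Complex.exp (Complex.I * ω * x) = 0)
    (hbound : ∃ B : ℝ, ∀ ω ≥ Ω, ∀ k : ℕ, ‖(p ω).coeff k‖ ≤ B)
    (hroots : ∀ ω ≥ Ω, p ω = ∏ j, (X - Polynomial.C (y ω j))) :
    ∃ C Ω' : ℝ, Ω ≤ Ω' ∧ ∀ ω ≥ Ω', ∀ j : Fin (2 * n),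
      ∃ (s : ℂ) (l : Fin n), (s = 1 ∨ s = -1) ∧
        ‖y ω j - (s + Complex.I * (ξ l : ℂ) / (ω : ℂ))‖ ≤ C / ω ^ 2 := by
  choose K hK using key hn ξ η hξinj hGL Ω p hmonic horth hbound
  have hall := Filter.eventually_all.2 hK
  obtain ⟨Ω₁, hΩ₁⟩ := Filter.eventually_atTop.1 hall
  refine ⟨2 * n * ∑ l, |K l|, max Ω Ω₁, le_max_left _ _, ?_⟩
  intro ω hω j
  have h1 : Ω ≤ ω := (le_max_left _ _).trans hω
  have h2 : Ω₁ ≤ ω := (le_max_right _ _).trans hω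
  have hω0 : 0 < ω := hΩ.trans_le h1
  obtain ⟨l, hl⟩ := root_near hn (ndP ξ ω) (ndP_inj ξ hξinj hω0) (p ω) (hmonic ω h1).1
    (hmonic ω h1).2 ((∑ l, |K l|) / ω ^ 2) (fun l => (hΩ₁ ω h2 l).trans (by
      gcongr
      exact (le_abs_self _).trans
        (Finset.single_le_sum (f := fun l => |K l|) (fun _ _ => abs_nonneg _) (Finset.mem_univ l))))
    (y ω j) (by
      rw [hroots ω h1, eval_prod]
      exact Finset.prod_eq_zero (Finset.mem_univ j) (by simp))
  refine ⟨sgB l.1, l.2, by cases l.1 <;> simp [sgB], ?_⟩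
  rw [← mul_div_assoc] at hl
  exact hl
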